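/- arXiv:1607.00175 — 2 statements merged into one kernel-verified Lean document; each statement's English description precedes it below -/
import Mathlib

section
/- For every θ ∈ {−1, 0, 1}, admissible fugacity z, T > 0, ĉ > 0, u ∈ ℝ³, every symmetric traceless real 3×3 matrix σ = (σ_{ij}) and every q ∈ ℝ³, the quantum Grad 13-moment ansatz f_{G13} reproduces the prescribed 13 moments: ĉ∫_{ℝ³} f_{G13} dv = ρ, ĉ∫_{ℝ³} f_{G13}·c_i dv = 0 for i = 1,2,3, ĉ∫_{ℝ³} f_{G13}·c_i c_j dv = p·δ_{ij} + σ_{ij} for all i, j, and (ĉ/2)∫_{ℝ³} f_{G13}·c_i|c|² dv = q_i for i = 1,2,3. -/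
open Real MeasureTheory Matrix

/-- The quantum polylogarithm `𝓛_s(z)`. -/
noncomputable def qpolylog (θ s z : ℝ) : ℝ :=
  (1 / Real.Gamma s) * ∫ t in Set.Ioi (0:ℝ), t ^ (s - 1) / (z⁻¹ * Real.exp t + θ)

/-- Admissible fugacity: `z > 0`, and additionally `z < 1` for Bosons (`θ = -1`). -/
def admissible (θ z : ℝ) : Prop := 0 < z ∧ (θ = -1 → z < 1)

/-- Pressure `p = ĉ(2πT)^{3/2}T𝓛₅`. -/
noncomputable def qpressure (θ z T c : ℝ) : ℝ :=
  c * (2 * Real.pi * T) ^ ((3:ℝ)/2) * T * qpolylog θ (5/2) z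

/-- The quantum Grad 13-moment ansatz `f_{G13}`. -/
noncomputable def fG13 (θ z T c : ℝ) (u : EuclideanSpace ℝ (Fin 3))
    (σ : Matrix (Fin 3) (Fin 3) ℝ) (q : Fin 3 → ℝ)
    (v : EuclideanSpace ℝ (Fin 3)) : ℝ :=
  let L3 := qpolylog θ (3/2) z
  let L5 := qpolylog θ (5/2) z
  let L7 := qpolylog θ (7/2) z
  let L9 := qpolylog θ (9/2) z
  let p := qpressure θ z T c
  let B := (7/2) * L9 / L5 - (5/2) * L7^2 / L5^2
  (z⁻¹ * Real.exp (‖v - u‖^2 / (2*T)) + θ)⁻¹ *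
    (1 + (∑ i, ∑ j, (σ i j / (2 * p)) * (L5 / L7) *
            ((v i - u i) * (v j - u j) / T - (if i = j then (1:ℝ) else 0) * (L5 / L3)))
      + ∑ i, (B⁻¹ * q i / (5 * p * T)) * (v i - u i) * (‖v - u‖^2 / T - 5 * L7 / L5))


section radial
variable {E : Type*} [NormedAddCommGroup E] [InnerProductSpace ℝ E] [FiniteDimensional ℝ E]
  [MeasurableSpace E] [BorelSpace E]

theorem integrable_radial_mul {G : ℝ → ℝ}
    (hG : ∀ n : ℕ, Integrable fun w : E => G ‖w‖ * ‖w‖ ^ n) {P : E → ℝ} (hP : Continuous P)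
    (n : ℕ) (hb : ∀ w, |P w| ≤ ‖w‖ ^ n) : Integrable fun w : E => G ‖w‖ * P w := by
  have h0 : AEStronglyMeasurable (fun w : E => G ‖w‖) volume := by
    simpa using (hG 0).aestronglyMeasurable
  refine (hG n).mono (h0.mul hP.aestronglyMeasurable) (.of_forall fun w => ?_)
  rw [norm_mul, norm_mul, Real.norm_eq_abs (P w), norm_pow, norm_norm]
  gcongr
  exact hb w

theorem integral_radial_mul_odd (G : ℝ → ℝ) {P : E → ℝ} (hP : ∀ w, P (-w) = -P w) :
    ∫ w : E, G ‖w‖ * P w = 0 := by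
  have h := integral_neg_eq_self (fun w : E => G ‖w‖ * P w) volume
  simp only [norm_neg, hP, mul_neg, integral_neg] at h
  linarith

theorem integral_radial_inner_eq (G g : ℝ → ℝ) {a b : E} (hab : ‖a‖ = ‖b‖) :
    ∫ w : E, G ‖w‖ * g (inner ℝ a w) = ∫ w : E, G ‖w‖ * g (inner ℝ b w) := by
  set R := Submodule.reflection (Submodule.span ℝ {a - b})ᗮ
  have hR : R a = b := Submodule.reflection_sub hab
  rw [← R.measurePreserving.integral_comp R.toHomeomorph.measurableEmbedding
    (fun w => G ‖w‖ * g (inner ℝ b w))]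
  simp_rw [← hR, LinearIsometryEquiv.norm_map, LinearIsometryEquiv.inner_map_map]

theorem integral_radial_inner_pow (G : ℝ → ℝ) {e : E} (he : ‖e‖ = 1) (a : E) (n : ℕ) :
    ∫ w : E, G ‖w‖ * inner ℝ a w ^ n =
      ‖a‖ ^ n * ∫ w : E, G ‖w‖ * inner ℝ e w ^ n := by
  rw [integral_radial_inner_eq G (· ^ n) (b := ‖a‖ • e) (by simp [norm_smul, he]),
    ← integral_const_mul]
  congr 1 with w
  rw [real_inner_smul_left]
  ring

theorem integrable_radial_inner_pow {G : ℝ → ℝ}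
    (hG : ∀ n : ℕ, Integrable fun w : E => G ‖w‖ * ‖w‖ ^ n) (a : E) (n : ℕ) :
    Integrable fun w : E => G ‖w‖ * inner ℝ a w ^ n := by
  rcases eq_or_ne a 0 with rfl | ha
  · simpa using (hG 0).mul_const ((0 : ℝ) ^ n)
  · have ha' : ‖a‖ ≠ 0 := norm_ne_zero_iff.2 ha
    refine ((integrable_radial_mul hG (P := fun w => (inner ℝ a w / ‖a‖) ^ n)
      (by fun_prop) n fun w => ?_).const_mul (‖a‖ ^ n)).congr (.of_forall fun w => ?_)
    · rw [abs_pow, abs_div, abs_norm]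
      gcongr
      rw [div_le_iff₀' (norm_pos_iff.2 ha)]
      exact abs_real_inner_le_norm _ _
    · simp only [div_pow]
      field_simp

theorem integral_radial_inner_mul_inner {G : ℝ → ℝ}
    (hG : ∀ n : ℕ, Integrable fun w : E => G ‖w‖ * ‖w‖ ^ n) {e : E} (he : ‖e‖ = 1) (a b : E) :
    ∫ w : E, G ‖w‖ * (inner ℝ a w * inner ℝ b w) =
      inner ℝ a b * ∫ w : E, G ‖w‖ * inner ℝ e w ^ 2 := by
  have hi := fun x : E => integrable_radial_inner_pow hG x 2
  calc _ = ∫ w : E, ((1 / 4) * (G ‖w‖ * inner ℝ (a + b) w ^ 2)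
        - (1 / 4) * (G ‖w‖ * inner ℝ (a - b) w ^ 2)) := by
        congr 1 with w
        simp only [inner_add_left, inner_sub_left]
        ring
    _ = _ := by
      rw [integral_sub ((hi _).const_mul _) ((hi _).const_mul _)]
      simp only [integral_const_mul, integral_radial_inner_pow G he (a + b),
        integral_radial_inner_pow G he (a - b)]
      simp only [← real_inner_self_eq_norm_sq,
        inner_add_left, inner_sub_left, inner_add_right, inner_sub_right, real_inner_comm a b]
      ring

theorem integral_radial_inner_mul_four {G : ℝ → ℝ}
    (hG : ∀ n : ℕ, Integrable fun w : E => G ‖w‖ * ‖w‖ ^ n) {e : E} (he : ‖e‖ = 1)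
    (a b c d : E) :
    ∫ w : E, G ‖w‖ * (inner ℝ a w * inner ℝ b w * (inner ℝ c w * inner ℝ d w)) =
      (inner ℝ a b * inner ℝ c d + inner ℝ a c * inner ℝ b d + inner ℝ a d * inner ℝ b c) *
        ((1 / 3) * ∫ w : E, G ‖w‖ * inner ℝ e w ^ 4) := by
  have hi := fun x : E => (integrable_radial_inner_pow hG x 4).const_mul (1 / 192)
  calc _ = ∫ w : E, ((1 / 192) * (G ‖w‖ * inner ℝ (a + b + c + d) w ^ 4)
        + (1 / 192) * (G ‖w‖ * inner ℝ (a + b - c - d) w ^ 4)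
        + (1 / 192) * (G ‖w‖ * inner ℝ (a - b + c - d) w ^ 4)
        + (1 / 192) * (G ‖w‖ * inner ℝ (a - b - c + d) w ^ 4)
        - (1 / 192) * (G ‖w‖ * inner ℝ (a + b + c - d) w ^ 4)
        - (1 / 192) * (G ‖w‖ * inner ℝ (a + b - c + d) w ^ 4)
        - (1 / 192) * (G ‖w‖ * inner ℝ (a - b + c + d) w ^ 4)
        - (1 / 192) * (G ‖w‖ * inner ℝ (a - b - c - d) w ^ 4)) := by
        congr 1 with w
        simp only [inner_add_left, inner_sub_left]
        ring
    _ = _ := by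
      have h4 : ∀ x : E, ‖x‖ ^ 4 = inner ℝ x x ^ 2 := fun x => by
        rw [real_inner_self_eq_norm_sq]; ring
      rw [integral_sub (by fun_prop) (hi _), integral_sub (by fun_prop) (hi _),
        integral_sub (by fun_prop) (hi _), integral_sub (by fun_prop) (hi _),
        integral_add (by fun_prop) (hi _), integral_add (by fun_prop) (hi _),
        integral_add (hi _) (hi _)]
      simp only [integral_const_mul, integral_radial_inner_pow G he (_ + d),
        integral_radial_inner_pow G he (_ - d)]
      simp only [h4,
        inner_add_left, inner_sub_left, inner_add_right, inner_sub_right, real_inner_comm a b,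
        real_inner_comm a c, real_inner_comm a d,
        real_inner_comm b c, real_inner_comm b d, real_inner_comm c d]
      ring
end radial

theorem EuclideanSpace.integral_radial_apply_mul_apply {n : ℕ} {G : ℝ → ℝ}
    (hG : ∀ m : ℕ, Integrable fun w : EuclideanSpace ℝ (Fin (n + 1)) => G ‖w‖ * ‖w‖ ^ m)
    (i j : Fin (n + 1)) :
    ∫ w : EuclideanSpace ℝ (Fin (n + 1)), G ‖w‖ * (w i * w j) =
      (if i = j then 1 else 0) *
        ((∫ w : EuclideanSpace ℝ (Fin (n + 1)), G ‖w‖ * ‖w‖ ^ 2) / (n + 1)) := by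
  have hn : (n : ℝ) + 1 ≠ 0 := by positivity
  have key := fun i j => integral_radial_inner_mul_inner hG
    (e := EuclideanSpace.single 0 1) (by simp) (EuclideanSpace.single i 1)
    (EuclideanSpace.single j 1)
  set K := ∫ w : EuclideanSpace ℝ (Fin (n + 1)),
    G ‖w‖ * inner ℝ (EuclideanSpace.single 0 1) w ^ 2
  have hi : ∀ i j, Integrable fun w : EuclideanSpace ℝ (Fin (n + 1)) => G ‖w‖ * (w i * w j) :=
    fun i j => integrable_radial_mul hG (by fun_prop) 2 fun w => by
      rw [abs_mul, sq]
      exact mul_le_mul (PiLp.norm_apply_le w i) (PiLp.norm_apply_le w j) (abs_nonneg _)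
        (norm_nonneg _)
  simp only [EuclideanSpace.inner_single_left, map_one, one_mul, PiLp.single_apply] at key
  have hM : ∫ w : EuclideanSpace ℝ (Fin (n + 1)), G ‖w‖ * ‖w‖ ^ 2 = (n + 1) * K := by
    simp_rw [EuclideanSpace.real_norm_sq_eq, Finset.mul_sum, sq]
    rw [integral_finsetSum _ fun i _ => hi i i]
    simp [key]
  rw [key, hM]
  field_simp

theorem EuclideanSpace.integral_radial_apply_mul_four {n : ℕ} {G : ℝ → ℝ}
    (hG : ∀ m : ℕ, Integrable fun w : EuclideanSpace ℝ (Fin (n + 1)) => G ‖w‖ * ‖w‖ ^ m)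
    (i j k l : Fin (n + 1)) :
    ∫ w : EuclideanSpace ℝ (Fin (n + 1)), G ‖w‖ * (w i * w j * (w k * w l)) =
      ((if i = j then 1 else 0) * (if k = l then 1 else 0) +
        (if i = k then 1 else 0) * (if j = l then 1 else 0) +
        (if i = l then 1 else 0) * (if j = k then 1 else 0)) *
        ((∫ w : EuclideanSpace ℝ (Fin (n + 1)), G ‖w‖ * ‖w‖ ^ 4) / ((n + 1) * (n + 3))) := by
  have key := fun i j k l => integral_radial_inner_mul_four hG
    (e := EuclideanSpace.single 0 1) (by simp) (EuclideanSpace.single i 1)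
    (EuclideanSpace.single j 1) (EuclideanSpace.single k 1) (EuclideanSpace.single l 1)
  set K := (1 / 3) * ∫ w : EuclideanSpace ℝ (Fin (n + 1)),
    G ‖w‖ * inner ℝ (EuclideanSpace.single 0 1) w ^ 4
  have hi : ∀ i j k l, Integrable fun w : EuclideanSpace ℝ (Fin (n + 1)) =>
      G ‖w‖ * (w i * w j * (w k * w l)) :=
    fun i j k l => integrable_radial_mul hG (by fun_prop) 4 fun w => by
      have h := fun i => (Real.norm_eq_abs (w i)).symm.trans_le (PiLp.norm_apply_le w i)
      calc |w i * w j * (w k * w l)| = |w i| * |w j| * (|w k| * |w l|) := by simp only [abs_mul]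
        _ ≤ ‖w‖ * ‖w‖ * (‖w‖ * ‖w‖) := by gcongr <;> exact h _
        _ = ‖w‖ ^ 4 := by ring
  simp only [EuclideanSpace.inner_single_left, map_one, one_mul, PiLp.single_apply] at key
  have hM : ∫ w : EuclideanSpace ℝ (Fin (n + 1)), G ‖w‖ * ‖w‖ ^ 4 =
      ((n + 1) * (n + 3)) * K := by
    have h4 : ∀ w : EuclideanSpace ℝ (Fin (n + 1)),
        G ‖w‖ * ‖w‖ ^ 4 = ∑ i, ∑ j, G ‖w‖ * (w i * w i * (w j * w j)) := fun w => by
      rw [show ‖w‖ ^ 4 = ‖w‖ ^ 2 * ‖w‖ ^ 2 by ring, EuclideanSpace.real_norm_sq_eq,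
        Finset.sum_mul_sum]
      simp only [Finset.mul_sum, sq]
    simp_rw [h4]
    rw [integral_finsetSum _ fun i _ => integrable_finsetSum _ fun j _ => hi i i j j]
    simp_rw [integral_finsetSum _ fun j _ => hi _ _ j j, key]
    simp [← Finset.sum_mul, Finset.sum_add_distrib]
    ring
  have h1 : (n : ℝ) + 1 ≠ 0 := by positivity
  have h3 : (n : ℝ) + 3 ≠ 0 := by positivity
  rw [key, hM]
  field_simp

/-- The radial profile of the quantum equilibrium distribution. -/
noncomputable def quantumProfile (θ z T r : ℝ) : ℝ :=
  (z⁻¹ * Real.exp (r ^ 2 / (2 * T)) + θ)⁻¹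

theorem exists_mul_exp_le {θ z : ℝ} (hθ : θ = -1 ∨ θ = 0 ∨ θ = 1) (hz : admissible θ z) :
    ∃ κ > 0, ∀ t ≥ 0, κ * Real.exp t ≤ z⁻¹ * Real.exp t + θ := by
  obtain ⟨h0, h1⟩ := hz
  have hi : 0 < z⁻¹ := inv_pos.2 h0
  rcases hθ with rfl | rfl | rfl
  · refine ⟨z⁻¹ - 1, sub_pos.2 ((one_lt_inv₀ h0).2 (h1 rfl)), fun t ht => ?_⟩
    have := Real.one_le_exp ht
    linarith
  · exact ⟨z⁻¹, hi, fun t _ => by linarith⟩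
  · exact ⟨z⁻¹, hi, fun t _ => by linarith⟩

theorem quantumProfile_den_pos {θ z T : ℝ} (hθ : θ = -1 ∨ θ = 0 ∨ θ = 1)
    (hz : admissible θ z) (hT : 0 < T) (r : ℝ) :
    0 < z⁻¹ * Real.exp (r ^ 2 / (2 * T)) + θ := by
  obtain ⟨κ, hκ, h⟩ := exists_mul_exp_le hθ hz
  exact (mul_pos hκ (Real.exp_pos _)).trans_le (h _ (by positivity))

theorem continuous_quantumProfile {θ z T : ℝ} (hθ : θ = -1 ∨ θ = 0 ∨ θ = 1)
    (hz : admissible θ z) (hT : 0 < T) : Continuous (quantumProfile θ z T) :=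
  Continuous.inv₀ (by fun_prop) fun r => (quantumProfile_den_pos hθ hz hT r).ne'

theorem integrable_quantumProfile_mul_pow {θ z T : ℝ} (hθ : θ = -1 ∨ θ = 0 ∨ θ = 1)
    (hz : admissible θ z) (hT : 0 < T) (n : ℕ) :
    Integrable fun w : EuclideanSpace ℝ (Fin 3) => quantumProfile θ z T ‖w‖ * ‖w‖ ^ n := by
  rw [integrable_fun_norm_addHaar volume (f := fun r => quantumProfile θ z T r * r ^ n)]
  obtain ⟨κ, hκ, h⟩ := exists_mul_exp_le hθ hz
  have hc := continuous_quantumProfile hθ hz hT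
  have hg := (integrableOn_rpow_mul_exp_neg_mul_sq (b := 1 / (2 * T)) (by positivity)
    (s := (2 + n : ℕ)) (by linarith [(2 + n : ℕ).cast_nonneg (α := ℝ)])).const_mul κ⁻¹
  refine hg.mono' (by fun_prop) ((ae_restrict_mem measurableSet_Ioi).mono fun r (hr : 0 < r) => ?_)
  have hd := quantumProfile_den_pos hθ hz hT r
  have hb : quantumProfile θ z T r ≤ κ⁻¹ * Real.exp (-(1 / (2 * T)) * r ^ 2) := by
    rw [show -(1 / (2 * T)) * r ^ 2 = -(r ^ 2 / (2 * T)) by ring, Real.exp_neg, ← mul_inv]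
    exact inv_anti₀ (by positivity) (h _ (by positivity))
  have h0 : 0 ≤ quantumProfile θ z T r := inv_nonneg.2 hd.le
  have hf : Module.finrank ℝ (EuclideanSpace ℝ (Fin 3)) - 1 = 2 := by simp
  rw [hf, smul_eq_mul, Real.norm_of_nonneg (by positivity), Real.rpow_natCast]
  calc r ^ 2 * (quantumProfile θ z T r * r ^ n) = r ^ (2 + n) * quantumProfile θ z T r := by ring
    _ ≤ r ^ (2 + n) * (κ⁻¹ * Real.exp (-(1 / (2 * T)) * r ^ 2)) := by gcongr
    _ = _ := by ring

theorem integral_quantumProfile_mul_pow (θ z : ℝ) {T : ℝ} (hT : 0 < T) (k : ℕ) :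
    ∫ w : EuclideanSpace ℝ (Fin 3), quantumProfile θ z T ‖w‖ * ‖w‖ ^ (2 * k) =
      2 * π * (2 * T) ^ ((k : ℝ) + 3 / 2) * Real.Gamma (k + 3 / 2) *
        qpolylog θ (k + 3 / 2) z := by
  have hΓ : Real.Gamma ((k : ℝ) + 3 / 2) ≠ 0 := (Real.Gamma_pos_of_pos (by positivity)).ne'
  have hf : Module.finrank ℝ (EuclideanSpace ℝ (Fin 3)) = 3 := by simp
  have hvol : (volume : Measure (EuclideanSpace ℝ (Fin 3))).real (Metric.ball 0 1) = π * 4 / 3 := by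
    rw [measureReal_def, EuclideanSpace.volume_ball_fin_three]
    simp [ENNReal.toReal_ofReal, show 0 ≤ π * 4 / 3 by positivity]
  rw [integral_fun_norm_addHaar volume (fun r => quantumProfile θ z T r * r ^ (2 * k)), hf, hvol,
    qpolylog]
  set g : ℝ → ℝ := fun t => t ^ ((k : ℝ) + 3 / 2 - 1) / (z⁻¹ * Real.exp t + θ)
  have h2 : ∫ y in Set.Ioi (0 : ℝ), g y = (2 * T)⁻¹ * (2 * (2 * T)⁻¹ ^ ((k : ℝ) + 1 / 2)) *
      ∫ r in Set.Ioi (0 : ℝ), r ^ 2 * (quantumProfile θ z T r * r ^ (2 * k)) := by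
    have h := integral_comp_mul_left_Ioi' g 0 (b := (2 * T)⁻¹) (by positivity)
    rw [mul_zero, ← integral_comp_rpow_Ioi (fun x => g ((2 * T)⁻¹ * x)) (two_ne_zero (α := ℝ))] at h
    rw [← h, smul_eq_mul, mul_assoc,
      ← integral_const_mul (2 * (2 * T)⁻¹ ^ ((k : ℝ) + 1 / 2))]
    congr 1
    refine setIntegral_congr_fun measurableSet_Ioi fun r (hr : 0 < r) => ?_
    have hp : ((2 * T)⁻¹ * r ^ 2) ^ ((k : ℝ) + 3 / 2 - 1) =
        (2 * T)⁻¹ ^ ((k : ℝ) + 1 / 2) * (r ^ (2 * k) * r) := by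
      rw [Real.mul_rpow (by positivity) (by positivity), ← Real.rpow_natCast_mul hr.le,
        ← pow_succ, ← Real.rpow_natCast r]
      push_cast
      congr 2 <;> ring
    simp only [smul_eq_mul, g, quantumProfile, Real.rpow_two, hp]
    norm_num
    ring_nf
  rw [h2]
  have hT2 : (2 * T) ^ ((k : ℝ) + 3 / 2) = (2 * T) * (2 * T) ^ ((k : ℝ) + 1 / 2) := by
    rw [show (k : ℝ) + 3 / 2 = 1 + (k + 1 / 2) by ring, Real.rpow_add (by positivity),
      Real.rpow_one]
  have hp : (2 * T) ^ ((k : ℝ) + 1 / 2) ≠ 0 := by positivity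
  rw [hT2, Real.inv_rpow (by positivity)]
  simp only [smul_eq_mul, nsmul_eq_mul]
  field_simp
  norm_num
  ring

theorem rpow_mul_Gamma_add_one {T : ℝ} (hT : 0 < T) {s : ℝ} (hs : 0 < s) :
    (2 * T) ^ (s + 1) * Real.Gamma (s + 1) = 2 * T * s * ((2 * T) ^ s * Real.Gamma s) := by
  rw [Real.rpow_add_one (by positivity), Real.Gamma_add_one hs.ne']
  ring

theorem rpow_mul_Gamma_three_halves {T : ℝ} (hT : 0 < T) :
    2 * π * ((2 * T) ^ (3 / 2 : ℝ) * Real.Gamma (3 / 2)) = (2 * π * T) ^ (3 / 2 : ℝ) := by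
  have hΓ : Real.Gamma (3 / 2) = √π / 2 := by
    rw [show (3 / 2 : ℝ) = 1 / 2 + 1 by norm_num, Real.Gamma_add_one (by norm_num),
      Real.Gamma_one_half_eq]
    ring
  have hp : π ^ (3 / 2 : ℝ) = √π * π := by
    rw [show (3 / 2 : ℝ) = 1 / 2 + 1 by norm_num, Real.rpow_add_one Real.pi_ne_zero,
      Real.sqrt_eq_rpow]
  rw [show 2 * π * T = 2 * T * π by ring, Real.mul_rpow (by positivity) Real.pi_nonneg, hΓ, hp]
  ring

theorem integral_quantumProfile (θ z : ℝ) {T : ℝ} (hT : 0 < T) :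
    ∫ w : EuclideanSpace ℝ (Fin 3), quantumProfile θ z T ‖w‖ =
      (2 * π * T) ^ (3 / 2 : ℝ) * qpolylog θ (3 / 2) z := by
  have h := integral_quantumProfile_mul_pow θ z hT 0
  norm_num at h
  rw [h, ← rpow_mul_Gamma_three_halves hT]
  ring

theorem integral_quantumProfile_mul_sq (θ z : ℝ) {T : ℝ} (hT : 0 < T) :
    ∫ w : EuclideanSpace ℝ (Fin 3), quantumProfile θ z T ‖w‖ * ‖w‖ ^ 2 =
      3 * T * (2 * π * T) ^ (3 / 2 : ℝ) * qpolylog θ (5 / 2) z := by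
  have h := integral_quantumProfile_mul_pow θ z hT 1
  have h1 := rpow_mul_Gamma_add_one hT (s := 3 / 2) (by norm_num)
  norm_num at h h1
  rw [h, mul_assoc (2 * π), h1, ← rpow_mul_Gamma_three_halves hT]
  ring

theorem integral_quantumProfile_mul_pow_four (θ z : ℝ) {T : ℝ} (hT : 0 < T) :
    ∫ w : EuclideanSpace ℝ (Fin 3), quantumProfile θ z T ‖w‖ * ‖w‖ ^ 4 =
      15 * T ^ 2 * (2 * π * T) ^ (3 / 2 : ℝ) * qpolylog θ (7 / 2) z := by
  have h := integral_quantumProfile_mul_pow θ z hT 2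
  have h1 := rpow_mul_Gamma_add_one hT (s := 3 / 2) (by norm_num)
  have h2 := rpow_mul_Gamma_add_one hT (s := 5 / 2) (by norm_num)
  norm_num at h h1 h2
  rw [h, mul_assoc (2 * π), h2, h1, ← rpow_mul_Gamma_three_halves hT]
  ring

theorem integral_quantumProfile_mul_pow_six (θ z : ℝ) {T : ℝ} (hT : 0 < T) :
    ∫ w : EuclideanSpace ℝ (Fin 3), quantumProfile θ z T ‖w‖ * ‖w‖ ^ 6 =
      105 * T ^ 3 * (2 * π * T) ^ (3 / 2 : ℝ) * qpolylog θ (9 / 2) z := by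
  have h := integral_quantumProfile_mul_pow θ z hT 3
  have h1 := rpow_mul_Gamma_add_one hT (s := 3 / 2) (by norm_num)
  have h2 := rpow_mul_Gamma_add_one hT (s := 5 / 2) (by norm_num)
  have h3 := rpow_mul_Gamma_add_one hT (s := 7 / 2) (by norm_num)
  norm_num at h h1 h2 h3
  rw [h, mul_assoc (2 * π), h3, h2, h1, ← rpow_mul_Gamma_three_halves hT]
  ring

theorem integral_quantumProfile_mul_pos {θ z T : ℝ} (hθ : θ = -1 ∨ θ = 0 ∨ θ = 1)
    (hz : admissible θ z) (hT : 0 < T) {g : ℝ → ℝ} (hg : Continuous g) (hg0 : ∀ r, 0 ≤ g r)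
    (hi : Integrable fun w : EuclideanSpace ℝ (Fin 3) => quantumProfile θ z T ‖w‖ * g ‖w‖)
    {r : ℝ} (hr : 0 ≤ r) (hgr : g r ≠ 0) :
    0 < ∫ w : EuclideanSpace ℝ (Fin 3), quantumProfile θ z T ‖w‖ * g ‖w‖ := by
  have hF : ∀ r, 0 < quantumProfile θ z T r :=
    fun r => inv_pos.2 (quantumProfile_den_pos hθ hz hT r)
  have hc := continuous_quantumProfile hθ hz hT
  refine integral_pos_of_integrable_nonneg_nonzero (x := EuclideanSpace.single 0 r) (by fun_prop)
    hi (fun w => mul_nonneg (hF _).le (hg0 _)) ?_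
  simpa [abs_of_nonneg hr, hgr] using (hF r).ne'

theorem qpolylog_five_halves_pos {θ z : ℝ} (hθ : θ = -1 ∨ θ = 0 ∨ θ = 1)
    (hz : admissible θ z) : 0 < qpolylog θ (5 / 2) z := by
  have h := integral_quantumProfile_mul_pos hθ hz one_pos (g := (· ^ 2)) (by fun_prop)
    (fun r => by positivity) (integrable_quantumProfile_mul_pow hθ hz one_pos 2) zero_le_one
    (by norm_num)
  rw [integral_quantumProfile_mul_sq θ z one_pos] at h
  exact pos_of_mul_pos_right h (by positivity)

theorem qpolylog_seven_halves_pos {θ z : ℝ} (hθ : θ = -1 ∨ θ = 0 ∨ θ = 1)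
    (hz : admissible θ z) : 0 < qpolylog θ (7 / 2) z := by
  have h := integral_quantumProfile_mul_pos hθ hz one_pos (g := (· ^ 4)) (by fun_prop)
    (fun r => by positivity) (integrable_quantumProfile_mul_pow hθ hz one_pos 4) zero_le_one
    (by norm_num)
  rw [integral_quantumProfile_mul_pow_four θ z one_pos] at h
  exact pos_of_mul_pos_right h (by positivity)

/-- Strict Cauchy–Schwarz: the heat-flux normalisation of the Grad ansatz is positive. -/
theorem qpolylog_heat_flux_factor_pos {θ z : ℝ} (hθ : θ = -1 ∨ θ = 0 ∨ θ = 1)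
    (hz : admissible θ z) :
    0 < 7 / 2 * qpolylog θ (9 / 2) z / qpolylog θ (5 / 2) z -
      5 / 2 * qpolylog θ (7 / 2) z ^ 2 / qpolylog θ (5 / 2) z ^ 2 := by
  have h5 := qpolylog_five_halves_pos hθ hz
  have h7 := qpolylog_seven_halves_pos hθ hz
  set μ := 5 * qpolylog θ (7 / 2) z / qpolylog θ (5 / 2) z with hμ
  have hμ0 : 0 < μ := by positivity
  have hi := fun n => integrable_quantumProfile_mul_pow hθ hz one_pos n
  have hexp : (fun w : EuclideanSpace ℝ (Fin 3) =>
      quantumProfile θ z 1 ‖w‖ * (‖w‖ ^ 2 * (‖w‖ ^ 2 - μ) ^ 2)) = fun w =>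
      quantumProfile θ z 1 ‖w‖ * ‖w‖ ^ 6 - 2 * μ * (quantumProfile θ z 1 ‖w‖ * ‖w‖ ^ 4) +
        μ ^ 2 * (quantumProfile θ z 1 ‖w‖ * ‖w‖ ^ 2) := by
    ext w
    ring
  have hsub : Integrable fun w : EuclideanSpace ℝ (Fin 3) =>
      quantumProfile θ z 1 ‖w‖ * ‖w‖ ^ 6 - 2 * μ * (quantumProfile θ z 1 ‖w‖ * ‖w‖ ^ 4) :=
    (hi 6).sub ((hi 4).const_mul (2 * μ))
  have h := integral_quantumProfile_mul_pos hθ hz one_pos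
    (g := fun r => r ^ 2 * (r ^ 2 - μ) ^ 2) (by fun_prop) (fun r => by positivity)
    (by rw [hexp]; exact hsub.add ((hi 2).const_mul (μ ^ 2))) (r := √(2 * μ)) (by positivity) (by
      rw [Real.sq_sqrt (by positivity)]
      exact mul_ne_zero (by positivity) (pow_ne_zero _ (by linarith)))
  rw [hexp, integral_add hsub ((hi 2).const_mul (μ ^ 2)),
    integral_sub (hi 6) ((hi 4).const_mul (2 * μ)), integral_const_mul, integral_const_mul,
    integral_quantumProfile_mul_sq θ z one_pos, integral_quantumProfile_mul_pow_four θ z one_pos,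
    integral_quantumProfile_mul_pow_six θ z one_pos] at h
  have hD : 0 < 30 * (2 * π * 1) ^ (3 / 2 : ℝ) * qpolylog θ (5 / 2) z := by positivity
  refine pos_of_mul_pos_right (b := _) (a := 30 * (2 * π * 1) ^ (3 / 2 : ℝ) * qpolylog θ (5 / 2) z)
    (h.trans_eq ?_) hD.le
  rw [hμ]
  field_simp
  ring

theorem integral_fG13_mul {θ z T c : ℝ} (hθ : θ = -1 ∨ θ = 0 ∨ θ = 1) (hz : admissible θ z)
    (hT : 0 < T) (u : EuclideanSpace ℝ (Fin 3)) {σ : Matrix (Fin 3) (Fin 3) ℝ} (q : Fin 3 → ℝ)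
    (htr : σ.trace = 0) {P : EuclideanSpace ℝ (Fin 3) → ℝ} (hP : Continuous P) (n : ℕ)
    (hb : ∀ w, |P w| ≤ ‖w‖ ^ n) :
    ∫ v, fG13 θ z T c u σ q v * P (v - u) =
      (∫ w, quantumProfile θ z T ‖w‖ * P w) +
      (∑ i, ∑ j, σ i j / (2 * qpressure θ z T c) *
        (qpolylog θ (5 / 2) z / qpolylog θ (7 / 2) z) / T *
          ∫ w, quantumProfile θ z T ‖w‖ * (w i * w j * P w)) +
      ∑ i, ((7 / 2) * qpolylog θ (9 / 2) z / qpolylog θ (5 / 2) z -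
          (5 / 2) * qpolylog θ (7 / 2) z ^ 2 / qpolylog θ (5 / 2) z ^ 2)⁻¹ * q i /
            (5 * qpressure θ z T c * T) *
          ((∫ w, quantumProfile θ z T ‖w‖ * (w i * P w * ‖w‖ ^ 2)) / T -
            5 * qpolylog θ (7 / 2) z / qpolylog θ (5 / 2) z *
              ∫ w, quantumProfile θ z T ‖w‖ * (w i * P w)) := by
  have hF := integrable_quantumProfile_mul_pow hθ hz hT
  have hw : ∀ (i : Fin 3) (w : EuclideanSpace ℝ (Fin 3)), |w i| ≤ ‖w‖ :=
    fun i w => PiLp.norm_apply_le w i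
  have i0 := integrable_radial_mul hF hP n hb
  have i1 : ∀ i : Fin 3, Integrable fun w => quantumProfile θ z T ‖w‖ * (w i * P w) :=
    fun i => integrable_radial_mul hF (by fun_prop) (1 + n) fun w => by
      rw [abs_mul, pow_add, pow_one]
      exact mul_le_mul (hw i w) (hb w) (abs_nonneg _) (norm_nonneg _)
  have i2 : ∀ i j : Fin 3, Integrable fun w => quantumProfile θ z T ‖w‖ * (w i * w j * P w) :=
    fun i j => integrable_radial_mul hF (by fun_prop) (2 + n) fun w => by
      rw [abs_mul, abs_mul, pow_add, sq]
      have := hw i w; have := hw j w; have := hb w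
      gcongr
  have i3 : ∀ i : Fin 3, Integrable fun w => quantumProfile θ z T ‖w‖ * (w i * P w * ‖w‖ ^ 2) :=
    fun i => integrable_radial_mul hF (by fun_prop) (1 + n + 2) fun w => by
      rw [abs_mul, abs_mul, abs_pow, abs_norm, pow_add, pow_add, pow_one]
      have := hw i w; have := hb w
      gcongr
  set p := qpressure θ z T c
  set L5 := qpolylog θ (5 / 2) z
  set L7 := qpolylog θ (7 / 2) z
  set a : Fin 3 → Fin 3 → ℝ := fun i j => σ i j / (2 * p) * (L5 / L7) / T
  set b : Fin 3 → ℝ := fun i => ((7 / 2) * qpolylog θ (9 / 2) z / L5 -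
    (5 / 2) * L7 ^ 2 / L5 ^ 2)⁻¹ * q i / (5 * p * T)
  obtain ⟨Φ, hΦ⟩ : ∃ Φ : EuclideanSpace ℝ (Fin 3) → ℝ, Φ = fun w =>
    quantumProfile θ z T ‖w‖ * P w +
      (∑ i, ∑ j, a i j * (quantumProfile θ z T ‖w‖ * (w i * w j * P w))) +
      ∑ i, b i * ((quantumProfile θ z T ‖w‖ * (w i * P w * ‖w‖ ^ 2)) / T -
        5 * L7 / L5 * (quantumProfile θ z T ‖w‖ * (w i * P w))) := ⟨_, rfl⟩
  have hexp : ∀ v, fG13 θ z T c u σ q v * P (v - u) = Φ (v - u) := fun v => by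
    rw [Matrix.trace_fin_three] at htr
    have h00 : σ 0 0 = -σ 1 1 - σ 2 2 := by linarith
    simp only [hΦ, fG13, quantumProfile, PiLp.sub_apply, Fin.sum_univ_three, a, b, p, L5, L7]
    simp [h00]
    ring
  rw [integral_congr_ae (.of_forall hexp), integral_sub_right_eq_self, hΦ]
  have s1 := fun i j => (i2 i j).const_mul (a i j)
  have s1' := fun i => integrable_finsetSum Finset.univ fun j _ => s1 i j
  have s1'' := integrable_finsetSum Finset.univ fun i _ => s1' i
  have s2 : ∀ i, Integrable fun w => b i * (quantumProfile θ z T ‖w‖ * (w i * P w * ‖w‖ ^ 2) / T -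
      5 * L7 / L5 * (quantumProfile θ z T ‖w‖ * (w i * P w))) :=
    fun i => (((i3 i).div_const T).sub ((i1 i).const_mul (5 * L7 / L5))).const_mul (b i)
  rw [integral_add (by exact i0.add s1'') (integrable_finsetSum _ fun i _ => s2 i),
    integral_add i0 s1'', integral_finsetSum _ fun i _ => s1' i,
    integral_finsetSum _ fun i _ => s2 i]
  simp_rw [integral_finsetSum _ fun j _ => s1 _ j, integral_const_mul]
  congr 2 with i
  rw [integral_sub ((i3 i).div_const T) ((i1 i).const_mul _), integral_div, integral_const_mul]

theorem integral_quantumProfile_apply_mul_apply_mul_pow {θ z T : ℝ}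
    (hθ : θ = -1 ∨ θ = 0 ∨ θ = 1) (hz : admissible θ z) (hT : 0 < T) (n : ℕ) (i j : Fin 3) :
    ∫ w : EuclideanSpace ℝ (Fin 3), quantumProfile θ z T ‖w‖ * (w i * w j * ‖w‖ ^ n) =
      (if i = j then 1 else 0) *
        ((∫ w : EuclideanSpace ℝ (Fin 3), quantumProfile θ z T ‖w‖ * ‖w‖ ^ (n + 2)) / 3) := by
  have h := EuclideanSpace.integral_radial_apply_mul_apply (n := 2)
    (G := fun r => quantumProfile θ z T r * r ^ n)
    (fun m => by simpa [mul_assoc, ← pow_add] using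
      integrable_quantumProfile_mul_pow hθ hz hT (n + m)) i j
  norm_num [mul_assoc, ← pow_add] at h ⊢
  rw [← h]
  congr 1 with w
  ring

/-- The quantum Grad 13-moment ansatz reproduces the prescribed 13 moments:
density `ρ`, zero velocity moments, pressure tensor `pδ_{ij} + σ_{ij}`, and heat
flux `q_i`. -/
theorem fG13_moments (θ z T c : ℝ)
    (hθ : θ = -1 ∨ θ = 0 ∨ θ = 1) (hz : admissible θ z) (hT : 0 < T) (hc : 0 < c)
    (u : EuclideanSpace ℝ (Fin 3)) (σ : Matrix (Fin 3) (Fin 3) ℝ) (q : Fin 3 → ℝ)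
    (hσ : σ.IsSymm) (htr : σ.trace = 0) :
    c * (∫ v : EuclideanSpace ℝ (Fin 3), fG13 θ z T c u σ q v) =
      c * (2 * Real.pi * T) ^ ((3:ℝ)/2) * qpolylog θ (3/2) z ∧
    (∀ i : Fin 3,
      c * (∫ v : EuclideanSpace ℝ (Fin 3), fG13 θ z T c u σ q v * (v i - u i)) = 0) ∧
    (∀ i j : Fin 3,
      c * (∫ v : EuclideanSpace ℝ (Fin 3),
          fG13 θ z T c u σ q v * (v i - u i) * (v j - u j)) =
        qpressure θ z T c * (if i = j then (1:ℝ) else 0) + σ i j) ∧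
    (∀ i : Fin 3,
      (c/2) * (∫ v : EuclideanSpace ℝ (Fin 3),
          fG13 θ z T c u σ q v * (v i - u i) * ‖v - u‖^2) = q i) := by
  have hp : qpressure θ z T c = c * (2 * π * T) ^ (3 / 2 : ℝ) * T * qpolylog θ (5 / 2) z := rfl
  have h5 := qpolylog_five_halves_pos hθ hz
  have h7 := qpolylog_seven_halves_pos hθ hz
  have hB := (qpolylog_heat_flux_factor_pos hθ hz).ne'
  have hw : ∀ (i : Fin 3) (w : EuclideanSpace ℝ (Fin 3)), |w i| ≤ ‖w‖ :=
    fun i w => PiLp.norm_apply_le w i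
  have quad := integral_quantumProfile_apply_mul_apply_mul_pow hθ hz hT
  have quad0 : ∀ i j : Fin 3, ∫ w : EuclideanSpace ℝ (Fin 3),
      quantumProfile θ z T ‖w‖ * (w i * w j) =
        (if i = j then 1 else 0) *
          (T * (2 * π * T) ^ (3 / 2 : ℝ) * qpolylog θ (5 / 2) z) := fun i j => by
    have h := quad 0 i j
    simp only [pow_zero, mul_one, zero_add, integral_quantumProfile_mul_sq θ z hT] at h
    rw [h]
    ring
  have quad2 : ∀ i j : Fin 3, ∫ w : EuclideanSpace ℝ (Fin 3),
      quantumProfile θ z T ‖w‖ * (w i * w j * ‖w‖ ^ 2) =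
        (if i = j then 1 else 0) *
          (5 * T ^ 2 * (2 * π * T) ^ (3 / 2 : ℝ) * qpolylog θ (7 / 2) z) := fun i j => by
    rw [quad 2 i j, integral_quantumProfile_mul_pow_four θ z hT]
    ring
  have quad4 : ∀ i j : Fin 3, ∫ w : EuclideanSpace ℝ (Fin 3),
      quantumProfile θ z T ‖w‖ * (w i * w j * ‖w‖ ^ 4) =
        (if i = j then 1 else 0) *
          (35 * T ^ 3 * (2 * π * T) ^ (3 / 2 : ℝ) * qpolylog θ (9 / 2) z) := fun i j => by
    rw [quad 4 i j, integral_quantumProfile_mul_pow_six θ z hT]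
    ring
  have odd : ∀ P : EuclideanSpace ℝ (Fin 3) → ℝ, (∀ w, P (-w) = -P w) →
      ∫ w, quantumProfile θ z T ‖w‖ * P w = 0 :=
    fun P hP => integral_radial_mul_odd _ hP
  refine ⟨?_, fun i => ?_, fun i j => ?_, fun i => ?_⟩
  · have h := integral_fG13_mul (c := c) hθ hz hT u q htr (P := fun _ => 1) continuous_const 0
      (by simp)
    simp only [mul_one] at h
    rw [h, integral_quantumProfile θ z hT]
    simp_rw [quad0]
    rw [Matrix.trace_fin_three] at htr
    have h00 : σ 0 0 = -σ 1 1 - σ 2 2 := by linarith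
    have h1 := fun i : Fin 3 => odd (fun w => w i) (by simp)
    have h3 := fun i : Fin 3 => odd (fun w => w i * ‖w‖ ^ 2) (by simp)
    simp only [h1, h3]
    simp [Fin.sum_univ_three, h00]
    ring
  · have h := integral_fG13_mul (c := c) hθ hz hT u q htr (P := fun w => w i) (by fun_prop) 1
      (by simpa using hw i)
    simp only [PiLp.sub_apply] at h
    have h1 := odd (fun w => w i) (by simp)
    have h3 := fun j k : Fin 3 => odd (fun w => w j * w k * w i) (by simp)
    simp only [h, h1, h3, quad0, quad2]
    have : ∀ k : Fin 3, (if k = i then (1 : ℝ) else 0) *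
        (5 * T ^ 2 * (2 * π * T) ^ (3 / 2 : ℝ) * qpolylog θ (7 / 2) z) / T -
        5 * qpolylog θ (7 / 2) z / qpolylog θ (5 / 2) z * ((if k = i then 1 else 0) *
          (T * (2 * π * T) ^ (3 / 2 : ℝ) * qpolylog θ (5 / 2) z)) = 0 := fun k => by
      field_simp
      ring
    simp only [this]
    simp
  · have h := integral_fG13_mul (c := c) hθ hz hT u q htr (P := fun w => w i * w j)
      (by fun_prop) 2 fun w => by
        rw [abs_mul, sq]
        exact mul_le_mul (hw i w) (hw j w) (abs_nonneg _) (norm_nonneg _)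
    simp only [PiLp.sub_apply, ← mul_assoc (fG13 θ z T c u σ q _)] at h
    have h3 := fun k : Fin 3 => odd (fun w => w k * (w i * w j)) (by simp)
    have h5' := fun k : Fin 3 => odd (fun w => w k * (w i * w j) * ‖w‖ ^ 2) (by simp)
    have quart := EuclideanSpace.integral_radial_apply_mul_four (n := 2)
      (integrable_quantumProfile_mul_pow hθ hz hT)
    simp only [Nat.reduceAdd, Nat.cast_ofNat] at quart
    simp only [h, h3, h5', quad0, quart, integral_quantumProfile_mul_pow_four θ z hT]
    have hs : ∑ k, ∑ l, σ k l * ((if k = l then (1 : ℝ) else 0) * (if i = j then 1 else 0) +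
        (if k = i then 1 else 0) * (if l = j then 1 else 0) +
        (if k = j then 1 else 0) * (if l = i then 1 else 0)) = 2 * σ i j := by
      have h1 : ∑ k, ∑ l, σ k l * ((if k = l then (1 : ℝ) else 0) * (if i = j then 1 else 0)) =
          σ.trace * (if i = j then 1 else 0) := by
        simp only [Matrix.trace, Matrix.diag, ← mul_assoc, ← Finset.sum_mul]
        simp
      have h2 : ∀ i j, ∑ k, ∑ l, σ k l * ((if k = i then (1 : ℝ) else 0) *
          (if l = j then 1 else 0)) = σ i j := fun i j => by simp
      simp only [mul_add, Finset.sum_add_distrib, h1, h2, htr, hσ.apply i j]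
      ring
    have hr : ∀ k l (δ : ℝ), σ k l / (2 * qpressure θ z T c) *
        (qpolylog θ (5 / 2) z / qpolylog θ (7 / 2) z) / T *
        (δ * (15 * T ^ 2 * (2 * π * T) ^ (3 / 2 : ℝ) * qpolylog θ (7 / 2) z /
          ((2 + 1) * (2 + 3)))) = (σ k l * δ) * (1 / (2 * c)) := fun k l δ => by
      rw [hp]
      field_simp
      norm_num
      ring
    simp only [hr]
    simp only [← Finset.sum_mul, hs, hp]
    simp only [zero_div, mul_zero, sub_self, add_zero]
    field_simp
  · have h := integral_fG13_mul (c := c) hθ hz hT u q htr (P := fun w => w i * ‖w‖ ^ 2)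
      (by fun_prop) 3 fun w => by
        rw [abs_mul, abs_pow, abs_norm, pow_succ' _ 2]
        have := hw i w
        gcongr
    simp only [PiLp.sub_apply, ← mul_assoc (fG13 θ z T c u σ q _)] at h
    have h1 := odd (fun w => w i * ‖w‖ ^ 2) (by simp)
    have h3 := fun j k : Fin 3 => odd (fun w => w j * w k * (w i * ‖w‖ ^ 2)) (by simp)
    have e2 : ∀ (k : Fin 3) (w : EuclideanSpace ℝ (Fin 3)),
        w k * (w i * ‖w‖ ^ 2) = w k * w i * ‖w‖ ^ 2 := fun k w => by ring
    have e4 : ∀ (k : Fin 3) (w : EuclideanSpace ℝ (Fin 3)),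
        w k * (w i * ‖w‖ ^ 2) * ‖w‖ ^ 2 = w k * w i * ‖w‖ ^ 4 := fun k w => by ring
    rw [h]
    simp only [h1, h3, e4]
    simp only [e2, quad2, quad4]
    set B := 7 / 2 * qpolylog θ (9 / 2) z / qpolylog θ (5 / 2) z -
      5 / 2 * qpolylog θ (7 / 2) z ^ 2 / qpolylog θ (5 / 2) z ^ 2 with hBdef
    have hr : ∀ k, B⁻¹ * q k / (5 * qpressure θ z T c * T) *
        ((if k = i then 1 else 0) *
          (35 * T ^ 3 * (2 * π * T) ^ (3 / 2 : ℝ) * qpolylog θ (9 / 2) z) / T -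
        5 * qpolylog θ (7 / 2) z / qpolylog θ (5 / 2) z * ((if k = i then 1 else 0) *
          (5 * T ^ 2 * (2 * π * T) ^ (3 / 2 : ℝ) * qpolylog θ (7 / 2) z))) =
        (if k = i then 2 / c * q k else 0) := fun k => by
      have hd : (35 * T ^ 3 * (2 * π * T) ^ (3 / 2 : ℝ) * qpolylog θ (9 / 2) z) / T -
          5 * qpolylog θ (7 / 2) z / qpolylog θ (5 / 2) z *
            (5 * T ^ 2 * (2 * π * T) ^ (3 / 2 : ℝ) * qpolylog θ (7 / 2) z) =
          B * (10 * T ^ 2 * (2 * π * T) ^ (3 / 2 : ℝ) * qpolylog θ (5 / 2) z) := by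
        rw [hBdef]
        field_simp
        ring
      split_ifs with hk
      · rw [one_mul, one_mul, hd, hp]
        field_simp
        ring
      · simp
    simp only [hr]
    simp
    field_simp
end

section
/- Let θ ∈ {−1, 0, 1} and let z, T : ℝ → ℝ be differentiable functions with T(x) > 0 and z(x) admissible for all x; define ρ(x) := ĉ(2πT(x))^{3/2}·𝓛_{3/2}(z(x)) and p(x) := ĉ(2πT(x))^{3/2}·T(x)·𝓛_{5/2}(z(x)). Then at every x the identity (5/2)·(1/ρ)·(ρ·T·𝓛₇/𝓛₅ − p)·(dp/dx) + (5/2)·p·(d/dx)(T·𝓛₇/𝓛₅) = (5/2)·p·((7/2)·𝓛₇/𝓛₅ − (5/2)·𝓛₅/𝓛₃)·(dT/dx) holds, where 𝓛_s is evaluated at z(x); this is the identity by which the first Maxwellian iteration of the regularized 13-moment system yields the correct quantum Fourier law. -/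
open Real

/-- The density field `ρ(x) = ĉ(2πT(x))^{3/2}𝓛_{3/2}(z(x))`. -/
noncomputable def rhoField (θ c : ℝ) (z T : ℝ → ℝ) (x : ℝ) : ℝ :=
  c * (2 * Real.pi * T x) ^ ((3:ℝ)/2) * qpolylog θ (3/2) (z x)

/-- The pressure field `p(x) = ĉ(2πT(x))^{3/2}T(x)𝓛_{5/2}(z(x))`. -/
noncomputable def pField (θ c : ℝ) (z T : ℝ → ℝ) (x : ℝ) : ℝ :=
  c * (2 * Real.pi * T x) ^ ((3:ℝ)/2) * T x * qpolylog θ (5/2) (z x)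

theorem exists_exp_le_fermi_denominator {θ z₀ : ℝ} (hθ : θ = -1 ∨ θ = 0 ∨ θ = 1)
    (h : admissible θ z₀) :
    ∃ k > 0, ∀ᶠ z in nhds z₀, 0 < z ∧ (z ^ 2)⁻¹ ≤ (z₀ ^ 2)⁻¹ + 1 ∧
      ∀ t ∈ Set.Ioi (0 : ℝ), k * exp t ≤ z⁻¹ * exp t + θ := by
  obtain ⟨hz, hz1⟩ := h
  have hpos : 0 < z₀⁻¹ + min θ 0 := by
    rcases hθ with rfl | rfl | rfl
    · have := (one_lt_inv₀ hz).2 (hz1 rfl)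
      norm_num
      linarith
    · simpa using hz
    · simpa using hz
  refine ⟨(z₀⁻¹ + min θ 0) / 2, by positivity, ?_⟩
  have h1 : ContinuousAt (fun z : ℝ => z⁻¹ + min θ 0) z₀ :=
    (continuousAt_inv₀ hz.ne').add continuousAt_const
  have h2 : ContinuousAt (fun z : ℝ => (z ^ 2)⁻¹) z₀ :=
    (continuousAt_id.pow 2).inv₀ (pow_ne_zero 2 hz.ne')
  filter_upwards [eventually_gt_nhds hz,
    h1.eventually (eventually_gt_nhds (half_lt_self hpos)),
    h2.eventually (eventually_lt_nhds (lt_add_one _))] with z hzp hk hC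
  refine ⟨hzp, hC.le, fun t ht => ?_⟩
  have he : 1 ≤ exp t := one_le_exp (le_of_lt ht)
  have h3 : min θ 0 * exp t ≤ θ := by
    nlinarith [min_le_left θ 0, min_le_right θ 0]
  nlinarith [mul_le_mul_of_nonneg_right hk.le (exp_pos t).le]

theorem integrableOn_rpow_div_fermi {θ k z s : ℝ} (hs : 0 < s) (hk : 0 < k)
    (hD : ∀ t ∈ Set.Ioi (0 : ℝ), k * exp t ≤ z⁻¹ * exp t + θ) :
    MeasureTheory.IntegrableOn (fun t : ℝ => t ^ (s - 1) / (z⁻¹ * exp t + θ)) (Set.Ioi 0) := by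
  refine MeasureTheory.Integrable.mono' ((GammaIntegral_convergent hs).const_mul k⁻¹) ?_ ?_
  · exact Measurable.aestronglyMeasurable (by fun_prop)
  · filter_upwards [MeasureTheory.ae_restrict_mem measurableSet_Ioi] with t ht
    have h0 : 0 < k * exp t := by positivity
    have ht0 : (0 : ℝ) < t := ht
    have hp : 0 ≤ t ^ (s - 1) := by positivity
    rw [norm_of_nonneg (div_nonneg hp (h0.le.trans (hD t ht)))]
    calc t ^ (s - 1) / (z⁻¹ * exp t + θ) ≤ t ^ (s - 1) / (k * exp t) :=
          div_le_div_of_nonneg_left hp h0 (hD t ht)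
      _ = k⁻¹ * (exp (-t) * t ^ (s - 1)) := by rw [exp_neg]; field_simp

theorem qpolylog_pos {θ s z : ℝ} (hθ : θ = -1 ∨ θ = 0 ∨ θ = 1) (h : admissible θ z)
    (hs : 0 < s) : 0 < qpolylog θ s z := by
  obtain ⟨k, hk, hev⟩ := exists_exp_le_fermi_denominator hθ h
  obtain ⟨-, -, hD⟩ := hev.self_of_nhds
  have hpos : ∀ t ∈ Set.Ioi (0 : ℝ), 0 < t ^ (s - 1) / (z⁻¹ * exp t + θ) := fun t ht =>
    div_pos (rpow_pos_of_pos ht _) ((mul_pos hk (exp_pos t)).trans_le (hD t ht))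
  refine mul_pos (one_div_pos.2 (Gamma_pos_of_pos hs)) ?_
  rw [MeasureTheory.setIntegral_pos_iff_support_of_nonneg_ae]
  · have : Function.support (fun t : ℝ => t ^ (s - 1) / (z⁻¹ * exp t + θ)) ∩ Set.Ioi 0
        = Set.Ioi 0 := Set.inter_eq_right.2 fun t ht => (hpos t ht).ne'
    rw [this]
    simp
  · filter_upwards [MeasureTheory.ae_restrict_mem measurableSet_Ioi] with t ht
    exact (hpos t ht).le
  · exact integrableOn_rpow_div_fermi hs hk hD

theorem integrableOn_const_mul_exp_neg_mul_rpow {s : ℝ} (hs : 0 < s) (C : ℝ) :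
    MeasureTheory.IntegrableOn (fun t : ℝ => C * (exp (-t) * t ^ s)) (Set.Ioi 0) := by
  simpa [MeasureTheory.IntegrableOn] using
    (GammaIntegral_convergent (add_pos hs one_pos)).const_mul C

theorem norm_rpow_mul_fermi_deriv_le {θ k C z s t : ℝ} (hk : 0 < k)
    (hC : (z ^ 2)⁻¹ ≤ C) (ht : 0 < t) (hD : k * exp t ≤ z⁻¹ * exp t + θ) :
    ‖t ^ s * ((z ^ 2)⁻¹ * exp t / (z⁻¹ * exp t + θ) ^ 2)‖
      ≤ C / k ^ 2 * (exp (-t) * t ^ s) := by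
  have h0 : 0 < k * exp t := by positivity
  have hp : 0 ≤ t ^ s := by positivity
  have hC0 : 0 ≤ C := le_trans (by positivity) hC
  rw [norm_of_nonneg (by positivity)]
  calc t ^ s * ((z ^ 2)⁻¹ * exp t / (z⁻¹ * exp t + θ) ^ 2)
      ≤ t ^ s * (C * exp t / (k * exp t) ^ 2) := by gcongr
    _ = C / k ^ 2 * (exp (-t) * t ^ s) := by rw [exp_neg]; field_simp

theorem integral_rpow_mul_fermi_deriv {θ k z s : ℝ} (hs : 0 < s) (hk : 0 < k) (hz : 0 < z)
    (hD : ∀ t ∈ Set.Ioi (0 : ℝ), k * exp t ≤ z⁻¹ * exp t + θ) :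
    ∫ t in Set.Ioi (0 : ℝ), t ^ s * ((z ^ 2)⁻¹ * exp t / (z⁻¹ * exp t + θ) ^ 2)
      = s / z * ∫ t in Set.Ioi (0 : ℝ), t ^ (s - 1) / (z⁻¹ * exp t + θ) := by
  have hDpos : ∀ t ∈ Set.Ioi (0 : ℝ), 0 < z⁻¹ * exp t + θ := fun t ht =>
    (mul_pos hk (exp_pos t)).trans_le (hD t ht)
  have hD0 : 0 < z⁻¹ * exp 0 + θ := by
    have hc1 : Filter.Tendsto (fun t : ℝ => k * exp t) (nhdsWithin 0 (Set.Ioi 0))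
        (nhds (k * exp 0)) := (by fun_prop : Continuous fun t : ℝ => k * exp t).continuousWithinAt
    have hc2 : Filter.Tendsto (fun t : ℝ => z⁻¹ * exp t + θ) (nhdsWithin 0 (Set.Ioi 0))
        (nhds (z⁻¹ * exp 0 + θ)) :=
      (by fun_prop : Continuous fun t : ℝ => z⁻¹ * exp t + θ).continuousWithinAt
    exact (mul_pos hk (exp_pos 0)).trans_le
      (le_of_tendsto_of_tendsto hc1 hc2 (by
        filter_upwards [self_mem_nhdsWithin] with t ht using hD t ht))
  have hu : ∀ t ∈ Set.Ioi (0 : ℝ), HasDerivAt (fun t : ℝ => t ^ s) (s * t ^ (s - 1)) t :=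
    fun t ht => hasDerivAt_rpow_const (Or.inl (ne_of_gt ht))
  have hv : ∀ t ∈ Set.Ioi (0 : ℝ), HasDerivAt (fun t : ℝ => -z⁻¹ * (z⁻¹ * exp t + θ)⁻¹)
      ((z ^ 2)⁻¹ * exp t / (z⁻¹ * exp t + θ) ^ 2) t := fun t ht => by
    have h := (((((hasDerivAt_exp t).const_mul z⁻¹).add_const θ).inv
      (hDpos t ht).ne').const_mul (-z⁻¹))
    refine h.congr_deriv ?_
    field_simp
  have hint := integrableOn_rpow_div_fermi hs hk hD
  have hibp := MeasureTheory.integral_Ioi_mul_deriv_eq_deriv_mul (a' := 0) (b' := 0) hu hv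
    (MeasureTheory.Integrable.mono'
      (integrableOn_const_mul_exp_neg_mul_rpow hs ((z ^ 2)⁻¹ / k ^ 2))
      (Measurable.aestronglyMeasurable (by
        show Measurable fun t : ℝ => t ^ s * ((z ^ 2)⁻¹ * exp t / (z⁻¹ * exp t + θ) ^ 2)
        fun_prop))
      (by
        filter_upwards [MeasureTheory.ae_restrict_mem measurableSet_Ioi] with t ht
        exact norm_rpow_mul_fermi_deriv_le hk le_rfl ht (hD t ht)))
    ((hint.const_mul (-s / z)).congr (by
      filter_upwards with t
      simp only [Pi.mul_apply]
      ring))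
    (by
      have h1 : Filter.Tendsto (fun t : ℝ => t ^ s * (-z⁻¹ * (z⁻¹ * exp t + θ)⁻¹))
          (nhds 0) (nhds ((0 : ℝ) ^ s * (-z⁻¹ * (z⁻¹ * exp 0 + θ)⁻¹))) :=
        (continuousAt_rpow_const _ _ (Or.inr hs.le)).mul
          (continuousAt_const.mul (ContinuousAt.inv₀ (by fun_prop) hD0.ne'))
      rw [zero_rpow hs.ne', zero_mul] at h1
      exact h1.mono_left nhdsWithin_le_nhds)
    (by
      have h1 : Filter.Tendsto (fun t : ℝ => z⁻¹ * k⁻¹ * (t ^ s * exp (-1 * t))) Filter.atTop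
          (nhds 0) := by
        simpa using (tendsto_rpow_mul_exp_neg_mul_atTop_nhds_zero s 1 one_pos).const_mul
          (z⁻¹ * k⁻¹)
      refine squeeze_zero_norm' ?_ h1
      filter_upwards [Filter.eventually_gt_atTop 0] with t ht
      have hd := hDpos t ht
      have h0 : 0 < k * exp t := by positivity
      rw [Pi.mul_apply, norm_mul, norm_mul, norm_neg, norm_of_nonneg (by positivity),
        norm_of_nonneg (by positivity), norm_of_nonneg (by positivity)]
      calc t ^ s * (z⁻¹ * (z⁻¹ * exp t + θ)⁻¹) ≤ t ^ s * (z⁻¹ * (k * exp t)⁻¹) := by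
            gcongr
            exact hD t ht
        _ = z⁻¹ * k⁻¹ * (t ^ s * exp (-1 * t)) := by
            rw [neg_one_mul, exp_neg]; field_simp)
  rw [hibp, ← MeasureTheory.integral_const_mul, sub_zero, zero_sub, ← MeasureTheory.integral_neg]
  congr 1
  ext t
  ring

/-- The recurrence `z 𝓛ₛ₊₁' = 𝓛ₛ` for the quantum polylogarithm. -/
theorem hasDerivAt_qpolylog {θ s z : ℝ} (hθ : θ = -1 ∨ θ = 0 ∨ θ = 1) (h : admissible θ z)
    (hs : 0 < s) : HasDerivAt (qpolylog θ (s + 1)) (qpolylog θ s z / z) z := by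
  obtain ⟨k, hk, hev⟩ := exists_exp_le_fermi_denominator hθ h
  obtain ⟨hz, -, hD⟩ := hev.self_of_nhds
  have key := (hasDerivAt_integral_of_dominated_loc_of_deriv_le
    (μ := MeasureTheory.volume.restrict (Set.Ioi 0))
    (F := fun y t : ℝ => t ^ (s + 1 - 1) / (y⁻¹ * exp t + θ))
    (F' := fun y t : ℝ => t ^ s * ((y ^ 2)⁻¹ * exp t / (y⁻¹ * exp t + θ) ^ 2))
    (bound := fun t : ℝ => ((z ^ 2)⁻¹ + 1) / k ^ 2 * (exp (-t) * t ^ s))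
    hev
    (Filter.Eventually.of_forall fun y => Measurable.aestronglyMeasurable (by fun_prop))
    (integrableOn_rpow_div_fermi (add_pos hs one_pos) hk hD)
    (Measurable.aestronglyMeasurable (by fun_prop))
    (by
      filter_upwards [MeasureTheory.ae_restrict_mem measurableSet_Ioi] with t ht y hy
      exact norm_rpow_mul_fermi_deriv_le hk hy.2.1 ht (hy.2.2 t ht))
    (integrableOn_const_mul_exp_neg_mul_rpow hs _)
    (by
      filter_upwards [MeasureTheory.ae_restrict_mem measurableSet_Ioi] with t ht y hy
      have hd : 0 < y⁻¹ * exp t + θ := (mul_pos hk (exp_pos t)).trans_le (hy.2.2 t ht)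
      have hy0 : 0 < y := hy.1
      have h1 := ((((hasDerivAt_inv hy0.ne').mul_const (exp t)).add_const θ).inv
        hd.ne').const_mul (t ^ s)
      simp only [add_sub_cancel_right, div_eq_mul_inv (t ^ s)]
      refine h1.congr_deriv ?_
      ring)).2
  rw [integral_rpow_mul_fermi_deriv hs hk hz hD] at key
  refine (key.const_mul (1 / Gamma (s + 1))).congr_deriv ?_
  have hG := (Gamma_pos_of_pos hs).ne'
  rw [Gamma_add_one hs.ne', qpolylog]
  field_simp

/-- The identity by which the first Maxwellian iteration of the regularized quantum
13-moment system yields the correct quantum Fourier law. -/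
theorem maxwellian_iteration_fourier_law (θ c : ℝ)
    (hθ : θ = -1 ∨ θ = 0 ∨ θ = 1) (hc : 0 < c) (z T : ℝ → ℝ)
    (hz : Differentiable ℝ z) (hT : Differentiable ℝ T)
    (hTpos : ∀ x, 0 < T x) (hadm : ∀ x, admissible θ (z x)) (x : ℝ) :
    (5/2) * (1 / rhoField θ c z T x) *
        (rhoField θ c z T x * T x * qpolylog θ (7/2) (z x) / qpolylog θ (5/2) (z x)
          - pField θ c z T x) * deriv (pField θ c z T) x
      + (5/2) * pField θ c z T x *
        deriv (fun y => T y * qpolylog θ (7/2) (z y) / qpolylog θ (5/2) (z y)) x =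
    (5/2) * pField θ c z T x *
        ((7/2) * qpolylog θ (7/2) (z x) / qpolylog θ (5/2) (z x)
          - (5/2) * qpolylog θ (5/2) (z x) / qpolylog θ (3/2) (z x)) * deriv T x := by
  have hTx := hTpos x
  have hzx := (hadm x).1
  have hL3 := qpolylog_pos (s := 3 / 2) hθ (hadm x) (by norm_num)
  have hL5 := qpolylog_pos (s := 5 / 2) hθ (hadm x) (by norm_num)
  have hdT := (hT x).hasDerivAt
  have hdz := (hz x).hasDerivAt
  have h5 : HasDerivAt (fun y => qpolylog θ (5 / 2) (z y))
      (qpolylog θ (3 / 2) (z x) / z x * deriv z x) x := by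
    have h := hasDerivAt_qpolylog (s := 3 / 2) hθ (hadm x) (by norm_num)
    norm_num at h
    exact h.comp x hdz
  have h7 : HasDerivAt (fun y => qpolylog θ (7 / 2) (z y))
      (qpolylog θ (5 / 2) (z x) / z x * deriv z x) x := by
    have h := hasDerivAt_qpolylog (s := 5 / 2) hθ (hadm x) (by norm_num)
    norm_num at h
    exact h.comp x hdz
  have hbase : 0 < 2 * π * T x := by positivity
  have hpow : HasDerivAt (fun y => (2 * π * T y) ^ ((3 : ℝ) / 2))
      (3 / 2 * (2 * π * T x) ^ ((3 : ℝ) / 2) * (deriv T x / T x)) x := by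
    refine ((hdT.const_mul (2 * π)).rpow_const (Or.inl hbase.ne')).congr_deriv ?_
    rw [rpow_sub_one hbase.ne']
    field_simp
  have hp := (((hpow.const_mul c).mul hdT).mul h5).deriv
  have hq := ((hdT.mul h7).div h5 hL5.ne').deriv
  have hP : 0 < (2 * π * T x) ^ ((3 : ℝ) / 2) := rpow_pos_of_pos hbase _
  change deriv (pField θ c z T) x = _ at hp
  change deriv (fun y => T y * qpolylog θ (7 / 2) (z y) / qpolylog θ (5 / 2) (z y)) x = _ at hq
  rw [hp, hq, rhoField, pField]
  simp only [Pi.mul_apply]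
  generalize (2 * π * T x) ^ ((3 : ℝ) / 2) = P at *
  field_simp
  ring
end
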